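/- arXiv:1704.05233 — 5 statements merged into one kernel-verified Lean document; each statement's English description precedes it below -/
import Mathlib

section
/- Let S be a string of length n that ends with terminator $. Then the multiset of characters of BWT_S equals the multiset of characters of S; that is, BWT_S is a rearrangement of the characters of S. -/
/-- The nonempty suffixes `S[j..n]` (for `1 ≤ j ≤ n`) of a string `S`,
listed from longest to shortest. -/
def suffixes {α : Type*} (S : List α) : List (List α) :=
  (List.range S.length).map (fun j => S.drop j)

/-- `S` ends with the terminator `dollar`: `S` is nonempty, its last character is `dollar`,
`dollar` occurs exactly once in `S`, and `dollar` is strictly smaller than every other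
character occurring in `S`. -/
def EndsWith {α : Type*} [LinearOrder α] (dollar : α) (S : List α) : Prop :=
  S ≠ [] ∧ S.getLast? = some dollar ∧ S.count dollar = 1 ∧
    ∀ a ∈ S, a ≠ dollar → dollar < a

/-- The Burrows–Wheeler transform of `S` (with terminator `dollar`): sort the nonempty
suffixes of `S` lexicographically; the `j`-th character of `BWT_S` is the character of `S`
immediately preceding the `j`-th smallest suffix `S[k..n]` (i.e. `S[k-1]`),
or `dollar` when that suffix is `S` itself (`k = 1`).  (A suffix of `S` is determined by
its length: the suffix `t` is `S[n-|t|+1..n]`, so its preceding character is `S[n-|t|]`,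
i.e. the character at 0-based index `n - |t| - 1`.) -/
def bwt {α : Type*} [LinearOrder α] (dollar : α) (S : List α) : List α :=
  (List.insertionSort (· ≤ ·) (suffixes S)).map
    (fun t => if t.length = S.length then dollar else S.getD (S.length - t.length - 1) dollar)

/-- `occ_{<c}(S)`: the number of occurrences in `S` of characters strictly smaller than `c`. -/
def occLt {α : Type*} [LinearOrder α] (c : α) (S : List α) : ℕ :=
  S.countP (fun a => decide (a < c))

/-- `rank_c(S, i) = occ_c(S[1..i])`: the number of occurrences of `c` among the first `i`
characters of `S`. -/
def rank {α : Type*} [DecidableEq α] (c : α) (S : List α) (i : ℕ) : ℕ :=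
  (S.take i).count c

/-- If `S` ends with terminator `dollar`, then `BWT_S` is a rearrangement (permutation)
of the characters of `S`. -/
theorem stmt1 {α : Type*} [LinearOrder α] (dollar : α) (S : List α)
    (h : EndsWith dollar S) : (bwt dollar S).Perm S := by
  obtain ⟨hne, hlast, -, -⟩ := h
  obtain ⟨T, rfl⟩ : ∃ T, S = T ++ [dollar] := by
    rw [List.getLast?_eq_some_iff] at hlast
    exact hlast
  have h1 : (bwt dollar (T ++ [dollar])).Perm (dollar :: T) := by
    unfold bwt
    refine ((List.perm_insertionSort _ _).map _).trans ?_
    refine List.Perm.of_eq ?_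
    apply List.ext_getElem
    · simp [suffixes]
    · intro i hi hi'
      simp only [List.length_cons] at hi'
      cases i with
      | zero => simp [suffixes]
      | succ k =>
        have e : T.length + 1 - (T.length + 1 - (k + 1)) - 1 = k := by omega
        have hk : k < T.length := by omega
        have hne : ¬ (T.length + 1 - (k + 1) = T.length + 1) := by omega
        simp only [suffixes, List.getElem_map, List.getElem_range, List.length_drop,
          List.length_append, List.length_singleton, List.getElem_cons_succ, if_neg hne, e]
        simp [List.getD, List.getElem?_append_left hk, hk]
  exact h1.trans (List.perm_append_singleton dollar T).symm
end

section
/- Let S be a string of length n that ends with terminator $, let i be the position of $ in BWT_S, and let c be a character with c ≠ $. Then the number of nonempty suffixes of S that begin with c and are lexicographically strictly smaller than the string cS equals rank_c(BWT_S, i). -/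
theorem take_eq_aux {α : Type*} [LinearOrder α] (L : List (List α)) (S : List α) (i : ℕ)
    (hs : L.Pairwise (· ≤ ·)) (hn : L.Nodup) (hi : i < L.length) (hS : L[i] = S)
    (p : List α → Bool) :
    (L.take (i+1)).countP p = L.countP (fun t => p t && decide (t ≤ S)) := by
  have e : L.countP (fun t => p t && decide (t ≤ S)) =
      (L.take (i+1) ++ L.drop (i+1)).countP (fun t => p t && decide (t ≤ S)) := by
    rw [List.take_append_drop]
  rw [e, List.countP_append]
  have h2 : (L.drop (i+1)).countP (fun t => p t && decide (t ≤ S)) = 0 := by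
    rw [List.countP_eq_zero]
    intro t ht
    obtain ⟨k, hk, rfl⟩ := List.mem_iff_getElem.1 ht
    simp only [List.length_drop] at hk
    simp only [List.getElem_drop, Bool.and_eq_true, decide_eq_true_eq, not_and]
    intro _ hle
    have h3 : L[i] ≤ L[i+1+k] := List.pairwise_iff_getElem.1 hs i (i+1+k) hi (by omega) (by omega)
    rw [hS] at h3
    have h4 : L[i+1+k] = L[i] := by rw [hS]; exact le_antisymm hle h3
    have := (hn.getElem_inj_iff).1 h4
    omega
  rw [h2, Nat.add_zero]
  apply List.countP_congr
  intro t ht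
  obtain ⟨k, hk, rfl⟩ := List.mem_iff_getElem.1 ht
  simp only [List.length_take] at hk
  have h3 : L[k] ≤ S := by
    rw [← hS]
    rcases Nat.lt_or_ge k i with h | h
    · exact List.pairwise_iff_getElem.1 hs k i (by omega) hi h
    · have : k = i := by omega
      subst this; exact le_refl _
  simp [List.getElem_take, h3]

/-- Let `S` end with terminator `dollar`, let `i` be the (1-indexed) position of `dollar`
in `BWT_S`, and let `c ≠ dollar`.  Then the number of nonempty suffixes of `S` that begin
with `c` and are lexicographically smaller than `cS` equals `rank_c(BWT_S, i)`. -/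
theorem stmt5 {α : Type*} [LinearOrder α] (dollar : α) (S : List α) (c : α) (i : ℕ)
    (h : EndsWith dollar S) (hc : c ≠ dollar)
    (hi1 : 1 ≤ i) (hi2 : i ≤ S.length)
    (hpos : (bwt dollar S).getD (i - 1) dollar = dollar) :
    (suffixes S).countP (fun t => decide (t.head? = some c ∧ t < c :: S)) =
      rank c (bwt dollar S) i := by
  obtain ⟨hne, hlast, hcount, -⟩ := h
  obtain ⟨i, rfl⟩ : ∃ k, i = k + 1 := ⟨i - 1, by omega⟩
  obtain ⟨m, hm⟩ : ∃ m, S.length = m + 1 := ⟨S.length - 1, by omega⟩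
  have hlast' : S[m]? = some dollar := by
    rw [List.getLast?_eq_getElem?, hm] at hlast; simpa using hlast
  have honly : ∀ j < m, S[j]? ≠ some dollar := by
    intro j hj hjd
    have e : S = S.take m ++ S.drop m := (List.take_append_drop m S).symm
    have h1 : dollar ∈ S.take m := by
      apply List.mem_of_getElem? (i := j)
      rw [List.getElem?_take_of_lt hj]; exact hjd
    have h2 : dollar ∈ S.drop m := by
      apply List.mem_of_getElem? (i := 0)
      rw [List.getElem?_drop]; simpa using hlast'
    have h1' := List.count_pos_iff.2 h1
    have h2' := List.count_pos_iff.2 h2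
    rw [e, List.count_append] at hcount
    omega
  have hnd : (suffixes S).Nodup := by
    unfold suffixes
    apply List.Nodup.map_on _ List.nodup_range
    intro x hx y hy hxy
    have := congrArg List.length hxy
    simp only [List.length_drop, List.mem_range] at *
    omega
  set L := List.insertionSort (· ≤ ·) (suffixes S) with hL
  have hperm : L.Perm (suffixes S) := List.perm_insertionSort _ _
  have hsort : L.Pairwise (· ≤ ·) := List.pairwise_insertionSort _ _
  have hLn : L.Nodup := hperm.nodup_iff.2 hnd
  have hlen : L.length = m + 1 := by rw [hperm.length_eq]; simp [suffixes, hm]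
  have hiL : i < L.length := by omega
  have hLS : L[i] = S := by
    have hmem : L[i] ∈ suffixes S := hperm.mem_iff.1 (List.getElem_mem hiL)
    unfold suffixes at hmem
    obtain ⟨j, hj, hjL⟩ := List.mem_map.1 hmem
    rw [List.mem_range] at hj
    simp only [bwt, ← hL] at hpos
    rw [List.getD_eq_getElem _ _ (by simpa using hiL)] at hpos
    simp only [Nat.add_sub_cancel, List.getElem_map, ← hjL, List.length_drop] at hpos
    rcases Nat.eq_zero_or_pos j with h0 | h0
    · subst h0; rw [← hjL]; simp
    · exfalso
      rw [if_neg (by omega), List.getD_eq_getElem _ _ (by omega)] at hpos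
      have hx : S.length - (S.length - j) - 1 = j - 1 := by omega
      simp only [hx] at hpos
      apply honly (j-1) (by omega)
      rw [List.getElem?_eq_getElem (by omega), hpos]
  unfold rank bwt
  rw [← hL, ← List.map_take, List.count, List.countP_map,
    take_eq_aux L S i hsort hLn hiL hLS, hperm.countP_eq]
  unfold suffixes
  rw [List.countP_map, List.countP_map, hm]
  conv_rhs => rw [List.range_succ_eq_map, List.countP_cons, List.countP_map]
  conv_lhs => rw [List.range_succ]
  rw [List.countP_append]
  have z1 : List.countP ((fun t => decide (t.head? = some c ∧ t < c :: S)) ∘ fun j => S.drop j) [m] = 0 := by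
    rw [List.countP_eq_zero]
    simp [hlast', Ne.symm hc]
  rw [z1]
  simp only [Function.comp, List.drop_zero, hm, if_true]
  have hdc : (dollar == c) = false := by simpa using Ne.symm hc
  simp only [hdc, Bool.false_and]
  simp only [Bool.false_eq_true, if_false, Nat.add_zero]
  apply List.countP_congr
  intro j hj
  rw [List.mem_range] at hj
  have hjS : j < S.length := by omega
  have hx : m + 1 - (S.length - (j+1)) - 1 = j := by omega
  have hne2 : ¬ (S.length - (j+1) = m + 1) := by omega
  have hneS : S.drop (j+1) ≠ S := by
    intro h; have := congrArg List.length h; simp at this; omega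
  simp only [Function.comp_apply, List.length_drop, Nat.succ_eq_add_one, hx, if_neg hne2, Bool.and_eq_true,
    beq_iff_eq, decide_eq_true_eq]
  rw [List.getD_eq_getElem _ _ hjS, List.drop_eq_getElem_cons hjS, List.head?_cons, Option.some_inj]
  apply and_congr_right
  intro hh
  rw [hh, List.cons_lt_cons_iff]
  simp only [lt_irrefl, false_or, true_and]
  exact ⟨fun h => le_of_lt h, fun h => lt_of_le_of_ne h hneS⟩
end

section
/- Let S be a string of length n that ends with terminator $, let i be the position of $ in BWT_S, and let c be a character with c ≠ $. Then the number of nonempty suffixes of S that are lexicographically strictly smaller than the string cS equals occ_{<c}(S) + rank_c(BWT_S, i); consequently, in the sorted list of nonempty suffixes of cS, the suffix cS occupies position occ_{<c}(S) + rank_c(BWT_S, i) + 1. -/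
theorem take_eq_filter_of_sorted {β : Type*} [LinearOrder β] (L : List β) (hL : L.Pairwise (· < ·))
    (k : ℕ) (x : β) (hk : L[k]? = some x) : L.take k = L.filter (fun t => decide (t < x)) := by
  induction L generalizing k with
  | nil => simp at hk
  | cons a L ih =>
    rw [List.pairwise_cons] at hL
    cases k with
    | zero =>
      simp at hk
      subst hk
      simp
      intro b hb
      exact (hL.1 b hb).le
    | succ k =>
      simp only [List.getElem?_cons_succ] at hk
      have hx : x ∈ L := List.mem_of_getElem? hk
      rw [List.take_succ_cons, ih hL.2 k hk, List.filter_cons_of_pos]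
      simpa using hL.1 x hx

theorem countP_eq_of_sorted {β : Type*} [LinearOrder β] (L : List β) (hL : L.Pairwise (· < ·))
    (k : ℕ) (x : β) (hk : L[k]? = some x) : L.countP (fun t => decide (t < x)) = k := by
  rw [List.countP_eq_length_filter, ← take_eq_filter_of_sorted L hL k x hk, List.length_take]
  have := (List.getElem?_eq_some_iff.1 hk).1
  omega

theorem suffixes_nodup {α : Type*} (S : List α) : (suffixes S).Nodup := by
  unfold suffixes
  rw [List.nodup_map_iff_inj_on List.nodup_range]
  intro x hx y hy hxy
  have := congrArg List.length hxy
  simp at hx hy this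
  omega

theorem sorted_suffixes {α : Type*} [LinearOrder α] (S : List α) :
    (List.insertionSort (· ≤ ·) (suffixes S)).Pairwise (· < ·) := by
  have h1 : (List.insertionSort (· ≤ ·) (suffixes S)).Pairwise (· ≤ ·) :=
    List.pairwise_insertionSort _ _
  have h2 : (List.insertionSort (· ≤ ·) (suffixes S)).Nodup :=
    (List.perm_insertionSort _ _).nodup_iff.2 (suffixes_nodup S)
  exact (h1.and h2).imp (fun h => lt_of_le_of_ne h.1 h.2)

theorem suffixes_cons {α : Type*} (c : α) (S : List α) :
    suffixes (c :: S) = (c :: S) :: suffixes S := by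
  simp [suffixes, List.range_succ_eq_map, Function.comp_def]

theorem countP_or_disjoint {β : Type*} (L : List β) (p q r : β → Prop)
    [DecidablePred p] [DecidablePred q] [DecidablePred r]
    (h : ∀ x ∈ L, (p x ↔ q x ∨ r x) ∧ ¬ (q x ∧ r x)) :
    L.countP (fun x => decide (p x)) =
      L.countP (fun x => decide (q x)) + L.countP (fun x => decide (r x)) := by
  induction L with
  | nil => simp
  | cons a L ih =>
    have h1 := h a (by simp)
    rw [List.countP_cons, List.countP_cons, List.countP_cons, ih (fun x hx => h x (by simp [hx]))]
    by_cases hq : q a <;> by_cases hr : r a <;> simp_all <;> omega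

theorem last_only {α : Type*} [LinearOrder α] (dollar : α) (S : List α)
    (h : EndsWith dollar S) (j : ℕ) (hj : j < S.length) :
    S.getD j dollar = dollar ↔ j + 1 = S.length := by
  obtain ⟨hne, hl, hcount, -⟩ := h
  obtain ⟨U, rfl⟩ : ∃ U, S = U ++ [dollar] := by
    rw [List.getLast?_eq_some_iff] at hl
    exact hl
  have hU : dollar ∉ U := by
    rw [List.count_append] at hcount
    simp at hcount
    exact List.count_eq_zero.1 hcount
  simp only [List.length_append, List.length_singleton] at hj ⊢
  rcases Nat.lt_or_ge j U.length with h1 | h1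
  · rw [List.getD_append _ _ _ _ h1, List.getD_eq_getElem _ _ h1]
    constructor
    · intro h2
      exact absurd (h2 ▸ List.getElem_mem h1) hU
    · omega
  · have : j = U.length := by omega
    subst this
    simp

theorem occLt_range {α : Type*} [LinearOrder α] (dollar c : α) (S : List α) :
    occLt c S = (List.range S.length).countP (fun j => decide (S.getD j dollar < c)) := by
  have : S = (List.range S.length).map (fun j => S.getD j dollar) := by
    apply List.ext_getElem
    · simp
    · intro k h1 h2
      simp [h1]
  unfold occLt
  conv_lhs => rw [this]
  rw [List.countP_map]
  rfl

theorem first_part {α : Type*} [LinearOrder α] (dollar : α) (S : List α) (c : α) (i : ℕ)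
    (h : EndsWith dollar S) (hc : c ≠ dollar)
    (hi1 : 1 ≤ i) (hi2 : i ≤ S.length)
    (hpos : (bwt dollar S).getD (i - 1) dollar = dollar) :
    (suffixes S).countP (fun t => decide (t < c :: S)) =
      occLt c S + rank c (bwt dollar S) i := by
  obtain ⟨k, rfl⟩ : ∃ k, i = k + 1 := ⟨i - 1, by omega⟩
  obtain ⟨m, hm⟩ : ∃ m, S.length = m + 1 := ⟨S.length - 1, by omega⟩
  simp only [Nat.add_sub_cancel] at hpos
  set f : List α → α := fun t => if t.length = S.length then dollar
    else S.getD (S.length - t.length - 1) dollar with hf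
  set L := List.insertionSort (· ≤ ·) (suffixes S) with hLdef
  have hperm : L.Perm (suffixes S) := List.perm_insertionSort _ _
  have hbwt : bwt dollar S = L.map f := rfl
  have hLlen : L.length = S.length := by
    rw [hperm.length_eq]; simp [suffixes]
  have hkL : k < L.length := by omega
  have hkS : L[k]? = some S := by
    rw [hbwt, List.getD_eq_getElem _ _ (by simpa using hkL), List.getElem_map] at hpos
    have hmem : L[k] ∈ suffixes S := hperm.mem_iff.1 (List.getElem_mem hkL)
    rw [List.getElem?_eq_getElem hkL]
    generalize L[k] = t at hpos hmem
    simp only [suffixes, List.mem_map, List.mem_range] at hmem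
    obtain ⟨j, hj, rfl⟩ := hmem
    simp only [hf, List.length_drop] at hpos
    split_ifs at hpos with h1
    · have : j = 0 := by omega
      subst this; simp
    · rw [last_only dollar S h _ (by omega)] at hpos
      omega
  have hrank : rank c (bwt dollar S) (k + 1) =
      (List.range m).countP (fun j => decide (S.getD j dollar = c ∧ S.drop (j + 1) < S)) := by
    have hfS : f S = dollar := by simp [hf]
    unfold rank
    rw [hbwt, ← List.map_take, List.take_add_one, hkS,
      take_eq_filter_of_sorted L (sorted_suffixes S) k S hkS]
    simp only [List.map_append, Option.toList_some, List.map_cons, List.map_nil,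
      List.count_append, hfS]
    rw [List.count_singleton]
    have : (dollar == c) = false := by simpa using Ne.symm hc
    simp only [this]
    rw [List.count, List.countP_map, List.countP_filter, hperm.countP_eq]
    simp only [suffixes, hm]
    rw [List.countP_map, List.range_succ_eq_map, List.countP_cons, List.countP_map]
    simp only [Function.comp_def, List.drop_zero, lt_irrefl]
    simp only [decide_false, Bool.and_false, Bool.false_eq_true, if_false, Nat.add_zero]
    apply List.countP_congr
    intro j hj
    rw [List.mem_range] at hj
    have e1 : ¬ (S.length - (j+1) = S.length) := by omega
    have e2 : S.length - (S.length - (j+1)) - 1 = j := by omega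
    simp [hf, e1, e2]
  rw [hrank, occLt_range dollar]
  have hlast : (List.range m).countP (fun j => decide (S.getD j dollar = c ∧ S.drop (j + 1) < S))
     = (List.range S.length).countP (fun j => decide (S.getD j dollar = c ∧ S.drop (j + 1) < S)) := by
    rw [hm, List.range_succ, List.countP_append]
    have : S.getD m dollar = dollar := (last_only dollar S h m (by omega)).2 hm.symm
    rw [List.countP_singleton, this]
    simp [Ne.symm hc]
  rw [hlast]
  unfold suffixes
  rw [List.countP_map]
  apply countP_or_disjoint (List.range S.length) (fun j => S.drop j < c :: S)
  intro j hj
  rw [List.mem_range] at hj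
  rw [List.drop_eq_getElem_cons hj, List.getD_eq_getElem _ _ hj, List.cons_lt_cons_iff]
  refine ⟨Iff.rfl, ?_⟩
  rintro ⟨h1, h2, -⟩
  exact absurd h2 h1.ne

/-- Let `S` end with terminator `dollar`, let `i` be the (1-indexed) position of `dollar`
in `BWT_S`, and let `c ≠ dollar`.  Then the number of nonempty suffixes of `S`
lexicographically smaller than `cS` equals `occ_{<c}(S) + rank_c(BWT_S, i)`; consequently,
in the lexicographically sorted list of nonempty suffixes of `cS`, the suffix `cS`
occupies (1-indexed) position `occ_{<c}(S) + rank_c(BWT_S, i) + 1`. -/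
theorem stmt6 {α : Type*} [LinearOrder α] (dollar : α) (S : List α) (c : α) (i : ℕ)
    (h : EndsWith dollar S) (hc : c ≠ dollar)
    (hi1 : 1 ≤ i) (hi2 : i ≤ S.length)
    (hpos : (bwt dollar S).getD (i - 1) dollar = dollar) :
    (suffixes S).countP (fun t => decide (t < c :: S)) =
      occLt c S + rank c (bwt dollar S) i ∧
    (List.insertionSort (· ≤ ·) (suffixes (c :: S))).getD
        (occLt c S + rank c (bwt dollar S) i) [] = c :: S := by
  have h1 := first_part dollar S c i h hc hi1 hi2 hpos
  refine ⟨h1, ?_⟩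
  rw [← h1]
  have hmem : (c :: S) ∈ List.insertionSort (· ≤ ·) (suffixes (c :: S)) := by
    rw [(List.perm_insertionSort (· ≤ ·) (suffixes (c :: S))).mem_iff, suffixes_cons]
    simp
  obtain ⟨k, hk⟩ := List.mem_iff_getElem?.1 hmem
  have h2 := countP_eq_of_sorted _ (sorted_suffixes (c :: S)) k _ hk
  rw [(List.perm_insertionSort (· ≤ ·) (suffixes (c :: S))).countP_eq, suffixes_cons,
    List.countP_cons_of_neg (by simp)] at h2
  have h3 : (suffixes S).countP (fun t => decide (t < c :: S)) = k := by
    rw [← h2]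
    congr!
  rw [h3, List.getD_eq_getElem?_getD, hk]
  rfl
end

section
/- Correctness of rank on run-length encoded strings: let S = c_1^{e_1} c_2^{e_2} ⋯ c_r^{e_r} be the run-length factorization of a string S of length n, let 1 ≤ i ≤ n, and let k be the minimal index with Σ_{j=1}^{k} e_j ≥ i. Then for any character c, rank_c(S, i) = (Σ_{1≤j≤k, c_j = c} e_j) − e, where e = Σ_{j=1}^{k} e_j − i if c_k = c and e = 0 otherwise. -/
/-- Decode a run-length factorization `[(c₁,e₁),…,(c_r,e_r)]` into the string
`c₁^{e₁} c₂^{e₂} ⋯ c_r^{e_r}`. -/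
def rleDecode {α : Type*} (l : List (α × ℕ)) : List α :=
  l.foldr (fun p acc => List.replicate p.2 p.1 ++ acc) []

/-- A valid run-length factorization: every exponent satisfies `e_j ≥ 1`, and the heads of
consecutive runs are distinct (`c_j ≠ c_{j+1}`). -/
def IsRLE {α : Type*} (l : List (α × ℕ)) : Prop :=
  (∀ p ∈ l, 1 ≤ p.2) ∧ l.Chain' (fun p q => p.1 ≠ q.1)

/-- `Σ_{j=1}^{k} e_j`: the total length of the first `k` runs. -/
def psum {α : Type*} (l : List (α × ℕ)) (k : ℕ) : ℕ :=
  ((l.take k).map Prod.snd).sum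

/-- `Σ_{1 ≤ j ≤ k, c_j = c} e_j`: the total length of the `c`-headed runs among the
first `k` runs. -/
def csum {α : Type*} [DecidableEq α] (c : α) (l : List (α × ℕ)) (k : ℕ) : ℕ :=
  (((l.take k).filter (fun p => decide (p.1 = c))).map Prod.snd).sum

theorem stmt11_aux {α : Type*} [DecidableEq α] (c : α) (d : α × ℕ) (l : List (α × ℕ)) :
    ∀ (i k : ℕ), k < l.length → psum l k ≤ i → i ≤ psum l (k + 1) →
    ((rleDecode l).take i).count c + (if (l.getD k d).1 = c then psum l (k + 1) - i else 0)
      = csum c l (k + 1) := by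
  induction l with
  | nil => intro i k h; simp at h
  | cons p l ih =>
    intro i k hk h1 h2
    have hd : rleDecode (p :: l) = List.replicate p.2 p.1 ++ rleDecode l := rfl
    have hp : ∀ m, psum (p :: l) (m + 1) = p.2 + psum l m := by intro m; simp [psum]
    have hc : ∀ m, csum c (p :: l) (m + 1) = (if p.1 = c then p.2 else 0) + csum c l m := by
      intro m
      by_cases h : p.1 = c <;> simp [csum, h]
    have hp0 : psum l 0 = 0 := by simp [psum]
    have hc0 : csum c l 0 = 0 := by simp [csum]
    rw [hd, hc, hp, List.take_append, List.count_append, List.take_replicate,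
      List.count_replicate, List.length_replicate]
    rw [hp] at h2
    cases k with
    | zero =>
      have e : i - p.2 = 0 := by omega
      rw [e, hp0, hc0]
      by_cases h : p.1 = c
      · simp [h]; omega
      · simp [h]
    | succ k =>
      rw [hp] at h1
      have := ih (i - p.2) k (by simpa using hk) (by omega) (by omega)
      rw [List.getD_cons_succ, ← this]
      have e : min i p.2 = p.2 := by omega
      have e2 : p.2 + psum l (k + 1) - i = psum l (k + 1) - (i - p.2) := by omega
      rw [e, e2]
      simp only [beq_iff_eq]
      omega

/-- Correctness of `rank` on run-length encoded strings: if `c₁^{e₁} ⋯ c_r^{e_r}` is the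
run-length factorization of `S`, `1 ≤ i ≤ n`, and `k` is the minimal index with
`Σ_{j=1}^{k} e_j ≥ i`, then for any character `c`,
`rank_c(S, i) = (Σ_{1≤j≤k, c_j = c} e_j) − e`, where `e = Σ_{j=1}^{k} e_j − i` if
`c_k = c` and `e = 0` otherwise.  (`c_k` is read off via `getD` with an arbitrary default;
the index `k - 1` is in range since `1 ≤ k ≤ r`.) -/
theorem stmt11 {α : Type*} [DecidableEq α] (S : List α) (l : List (α × ℕ)) (c : α)
    (i k : ℕ) (hl : IsRLE l) (hdec : rleDecode l = S)
    (hi1 : 1 ≤ i) (hi2 : i ≤ S.length)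
    (hk1 : 1 ≤ k) (hk2 : k ≤ l.length)
    (hks : i ≤ psum l k) (hkmin : ∀ k' < k, psum l k' < i) :
    (S.take i).count c =
      csum c l k - (if (l.getD (k - 1) (c, 0)).1 = c then psum l k - i else 0) := by
  subst hdec
  obtain ⟨k, rfl⟩ : ∃ m, k = m + 1 := ⟨k - 1, by omega⟩
  have := stmt11_aux c (c, 0) l i k (by omega) (hkmin k (by omega)).le hks
  rw [Nat.add_sub_cancel, ← this, Nat.add_sub_cancel]
end

section
/- Correctness of select on run-length encoded strings: let S = c_1^{e_1} c_2^{e_2} ⋯ c_r^{e_r} be the run-length factorization of a string S, let c be a character, and let 1 ≤ i ≤ occ_c(S). Let k be the minimal run index such that Σ_{1≤j≤k, c_j = c} e_j ≥ i. Then select_c(S, i) = Σ_{j=1}^{k−1} e_j + (i − Σ_{1≤j≤k−1, c_j = c} e_j), i.e., the position of the i-th occurrence of c in S is the total length of the first k−1 runs plus the rank of that occurrence inside the k-th run. -/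
/-- `select_c(S, i) = min { j | rank_c(S, j) = i }`, the position of the `i`-th occurrence
of `c` in `S` (1-indexed). -/
noncomputable def select {α : Type*} [DecidableEq α] (c : α) (S : List α) (i : ℕ) : ℕ :=
  sInf {j | (S.take j).count c = i}

theorem rleDecode_append_aux {α : Type*} (A B : List (α × ℕ)) :
    rleDecode (A ++ B) = rleDecode A ++ rleDecode B := by
  induction A with
  | nil => simp [rleDecode]
  | cons p A ih =>
    simp only [rleDecode, List.cons_append, List.foldr_cons, List.append_assoc] at *
    rw [ih]

theorem rleDecode_length_aux {α : Type*} (A : List (α × ℕ)) :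
    (rleDecode A).length = (A.map Prod.snd).sum := by
  induction A with
  | nil => simp [rleDecode]
  | cons p A ih =>
    simp only [rleDecode, List.foldr_cons, List.length_append, List.length_replicate,
      List.map_cons, List.sum_cons] at *
    rw [ih]

theorem rleDecode_count_aux {α : Type*} [DecidableEq α] (c : α) (A : List (α × ℕ)) :
    (rleDecode A).count c = ((A.filter (fun p => decide (p.1 = c))).map Prod.snd).sum := by
  induction A with
  | nil => simp [rleDecode]
  | cons p A ih =>
    simp only [rleDecode, List.foldr_cons, List.count_append, List.count_replicate] at *
    rw [ih]
    by_cases h : p.1 = c <;> simp [h]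

theorem take_count_aux {α : Type*} [DecidableEq α] (c : α) (A B : List α) (e m : ℕ)
    (hm : m ≤ e) :
    ((A ++ (List.replicate e c ++ B)).take (A.length + m)).count c = A.count c + m := by
  rw [List.take_length_add_append, List.take_append_of_le_length (by simpa using hm)]
  simp [hm]

/-- Correctness of `select` on run-length encoded strings: if `c₁^{e₁} ⋯ c_r^{e_r}` is the
run-length factorization of `S`, `1 ≤ i ≤ occ_c(S)`, and `k` is the minimal run index with
`Σ_{1≤j≤k, c_j=c} e_j ≥ i`, then
`select_c(S, i) = Σ_{j=1}^{k-1} e_j + (i − Σ_{1≤j≤k-1, c_j=c} e_j)`: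
the total length of the first `k-1` runs plus the rank of the occurrence inside the
`k`-th run. -/
theorem stmt12 {α : Type*} [DecidableEq α] (S : List α) (l : List (α × ℕ)) (c : α)
    (i k : ℕ) (hl : IsRLE l) (hdec : rleDecode l = S)
    (hi1 : 1 ≤ i) (hi2 : i ≤ S.count c)
    (hk1 : 1 ≤ k) (hk2 : k ≤ l.length)
    (hks : i ≤ csum c l k) (hkmin : ∀ k' < k, csum c l k' < i) :
    select c S i = psum l (k - 1) + (i - csum c l (k - 1)) := by
  obtain ⟨n, rfl⟩ : ∃ n, k = n + 1 := ⟨k - 1, by omega⟩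
  have hn : n < l.length := by omega
  have hmin := hkmin n (by omega)
  simp only [Nat.add_sub_cancel]
  have hsucc : csum c l (n + 1) = csum c l n + (if l[n].1 = c then l[n].2 else 0) := by
    simp only [csum]
    rw [← List.take_concat_get' l n hn, List.filter_append, List.map_append, List.sum_append]
    by_cases h : l[n].1 = c <;> simp [h]
  have hc : l[n].1 = c := by
    by_contra h
    simp only [h, if_false] at hsucc
    omega
  simp only [hc, if_true] at hsucc
  have hS : S = rleDecode (l.take n) ++
      (List.replicate l[n].2 c ++ rleDecode (l.drop (n + 1))) := by
    rw [← hdec]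
    conv_lhs => rw [← List.take_append_drop n l, rleDecode_append_aux,
      List.drop_eq_getElem_cons hn]
    simp only [rleDecode, List.foldr_cons, hc]
  have hlen : psum l n = (rleDecode (l.take n)).length := (rleDecode_length_aux _).symm
  have hcnt : csum c l n = (rleDecode (l.take n)).count c := (rleDecode_count_aux c _).symm
  have key : ∀ m ≤ l[n].2, (S.take (psum l n + m)).count c = csum c l n + m := by
    intro m hm
    rw [hS, hlen, hcnt]
    exact take_count_aux c _ _ _ m hm
  have hmem : psum l n + (i - csum c l n) ∈ {j | (S.take j).count c = i} := by
    have := key (i - csum c l n) (by omega)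
    simp only [Set.mem_setOf_eq]
    omega
  unfold select
  apply le_antisymm (Nat.sInf_le hmem)
  have hin := Nat.sInf_mem (Set.nonempty_of_mem hmem)
  by_contra hlt
  have hk := key (i - csum c l n - 1) (by omega)
  have hle := ((List.take_prefix_take_left (l := S)
    (show sInf {j | (S.take j).count c = i} ≤ psum l n + (i - csum c l n - 1) by
      omega)).sublist).count_le c
  simp only [Set.mem_setOf_eq] at hin
  omega
end
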